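/- Let $m,n$ be positive integers, $[n]=\{1,\dots,n\}$, and let $\mathcal A_m^n$ be the $m$-Catalan arrangement, i.e. the set of hyperplanes $\{x\in\mathbb R^n : x_i-x_j=s\}$ with $1\le i<j\le n$ and $s\in\{-m,\dots,m\}$. A \emph{face} of $\mathcal A_m^n$ is a nonempty set of the form $\bigcap_{H\in\mathcal A_m^n}\sigma_H$ where each $\sigma_H$ is $H$ or one of the two open half-spaces bounded by $H$; its codimension is that of its affine hull, and $\mathcal F(\mathcal A_m^n)$ is the set of faces. An \emph{$(m,n)$-tree} is a rooted $(m+1)$-ary tree with $n$ internal nodes labeled bijectively by (and identified with) $[n]$, the leaves being unlabeled; the ordered children of the node $j$ are $0\text{-child}(j),\dots,m\text{-child}(j)$. The node $i$ is the \emph{$s$-cadet} of $j$ if $i=s\text{-child}(j)$ and $t\text{-child}(j)$ is a leaf for all $s<t\le m$; then $\{i,j\}$ is a \emph{cadet edge}. If the path from the root to a vertex (node or leaf) $v$ successively takes the $s_1$-child, $\dots$, the $s_k$-child, put $\mathrm{path}_T(v)=(s_1,\dots,s_k)$ and $\mathrm{drift}_T(v)=s_1+\dots+s_k$. For \emph{distinct}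 vertices $v,w$ with $\mathrm{path}_T(v)=(s_1,\dots,s_k)$ and $\mathrm{path}_T(w)=(t_1,\dots,t_\ell)$, write $v\prec_T w$ if $\mathrm{drift}_T(v)<\mathrm{drift}_T(w)$, or $\mathrm{drift}_T(v)=\mathrm{drift}_T(w)$ and there is $p\le\min(k,\ell)$ with $(s_1,\dots,s_p)=(t_1,\dots,t_p)$ and ($p=k$, or $p<\min(k,\ell)$ and $s_{p+1}>t_{p+1}$); write $v\succeq_T w$ if $v=w$ or $w\prec_T v$. A \emph{marked $(m,n)$-tree} is a pair $(T,\mu)$ where $T$ is an $(m,n)$-tree and $\mu$ is a set of cadet edges of $T$ (the marked edges) such that $j<i$ whenever $\{i,j\}\in\mu$ and $i$ is the $0$-cadet of $j$. Let $\overline{\mathcal T}{}_m^n$ be the set of marked $(m,n)$-trees. Write $i\sim_\mu j$ if $i=j$ or all edges on the path of $T$ between $i$ and $j$ are marked; the equivalence classes are the \emph{blocks}. Let $\overline{\mathcal T}{}_m^n(\mathcal A_m^n)$ be the set of $(T,\mu)\in\overline{\mathcal T}{}_m^n$ such that (a) for every block $B$, the graph on $B$ with edges the pairs $\{i,j\}$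 for which $\{x_i-x_j=\mathrm{drift}_T(i)-\mathrm{drift}_T(j)\}\in\mathcal A_m^n$ is connected, and (b) for every non-marked cadet edge $\{i,j\}$ with $i$ the $s$-cadet of $j$, either ($s=0$ and $i<j$) or there are $i'\sim_\mu i$ and $j'\sim_\mu j$ with $\{x_{i'}-x_{j'}=\mathrm{drift}_T(i')-\mathrm{drift}_T(j')\}\in\mathcal A_m^n$. For $(T,\mu)\in\overline{\mathcal T}{}_m^n$ let $\overline\Phi(T,\mu)$ be the set of $x\in\mathbb R^n$ such that $x_i-x_j=s$ for every $\{i,j\}\in\mu$ with $i=s\text{-child}(j)$, and such that for all $i\ne j$ in $[n]$ and $s\in\{0,\dots,m\}$ with ($s>0$ or $i>j$) and $i\not\sim_\mu j$, one has $x_i-x_j<s$ if $i\prec_T s\text{-child}(j)$, and $x_i-x_j>s$ if $i\succeq_T s\text{-child}(j)$. Then $\overline{\mathcal T}{}_m^n(\mathcal A_m^n)=\overline{\mathcal T}{}_m^n$, and $\overline\Phi$ is a bijection from $\overline{\mathcal T}{}_m^n$ onto $\mathcal F(\mathcal A_m^n)$ which maps marked trees with $k$ marked edges to faces of codimension $k$.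 In particular, for each $k\ge 0$, $\overline\Phi$ restricts to a bijection from the marked $(m,n)$-trees having $k$ marked edges onto the faces of codimension $k$ of $\mathcal A_m^n$. -/

import Mathlib

namespace Braid

/-- The set `{x ∈ ℝ^n | x i - x j = s}` (a hyperplane when `i ≠ j`). The index set `[n]` is
`Fin n`, with its order. -/
def hyp (n : ℕ) (i j : Fin n) (s : ℝ) : Set (Fin n → ℝ) := {x | x i - x j = s}

/-- The `m`-Catalan arrangement `A_m^n`, as a set of hyperplanes of `ℝ^n`. -/
def catArr (m n : ℕ) : Set (Set (Fin n → ℝ)) :=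
  {H | ∃ i j : Fin n, ∃ s : ℤ, i < j ∧ -(m : ℤ) ≤ s ∧ s ≤ (m : ℤ) ∧ H = hyp n i j (s : ℝ)}

/-- `(i,j,s) ∈ Tr_m^n`. -/
def TrIdx (m n : ℕ) (i j : Fin n) (s : ℕ) : Prop := s ≤ m ∧ i ≠ j ∧ (0 < s ∨ j < i)

/-- `(i,j,s) ∈ Tr_m^n(A)`. -/
def TrIdxA (m n : ℕ) (A : Set (Set (Fin n → ℝ))) (i j : Fin n) (s : ℕ) : Prop :=
  TrIdx m n i j s ∧ hyp n i j (s : ℝ) ∈ A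

/-- An `(m,n)`-tree: a rooted `(m+1)`-ary tree with `n` internal nodes labeled bijectively by
`Fin n` (leaves unlabeled). The tree is given by the address of each node, that is, the list of
child indices along the path from the root: addresses have entries in `[0;m]`, distinct nodes
have distinct addresses, and every node other than the root has a parent. The vertices of the
tree are the nodes and the leaves; the `s`-child of node `j` (node or leaf) is the vertex with
address `path j ++ [s]`. -/
@[ext]
structure MTree (m n : ℕ) where
  path : Fin n → List ℕ
  entry_le : ∀ v : Fin n, ∀ s ∈ path v, s ≤ m
  inj : Function.Injective path
  parent_closed : ∀ v : Fin n, path v ≠ [] → ∃ w : Fin n, path w = (path v).dropLast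

namespace MTree

variable {m n : ℕ}

/-- The drift of a node. -/
def drift (T : MTree m n) (v : Fin n) : ℕ := (T.path v).sum

/-- The node `i` is the `s`-child of the node `j`. -/
def IsChild (T : MTree m n) (i j : Fin n) (s : ℕ) : Prop := T.path i = T.path j ++ [s]

/-- The node `i` is the `s`-cadet of the node `j`: it is the `s`-child of `j`, and the `t`-child
of `j` is a leaf for all `t ∈ [s+1;m]`. -/
def IsCadet (T : MTree m n) (i j : Fin n) (s : ℕ) : Prop :=
  T.IsChild i j s ∧ ∀ t : ℕ, s < t → t ≤ m → ¬ ∃ k, T.IsChild k j t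

end MTree

/-- The strict order `v ≺_T w` on vertices, in terms of the addresses `p` of `v` and `q` of `w`:
the vertices are distinct, and either `drift v < drift w`, or the drifts are equal and there is
`c ≤ k` (`k` the length of `p`) such that the first `c` entries of `p` and `q` agree and
(`c = k` or the next entry of `p` is larger than the next entry of `q`). -/
def vlt (p q : List ℕ) : Prop :=
  p ≠ q ∧
    (p.sum < q.sum ∨
      (p.sum = q.sum ∧ ∃ c ≤ p.length, p.take c = q.take c ∧
        (c = p.length ∨ ∃ (h1 : c < p.length) (h2 : c < q.length), q[c] < p[c])))

/-- `v ≽_T w`, in terms of the addresses `p` of `v` and `q` of `w`. -/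
def vge (p q : List ℕ) : Prop := p = q ∨ vlt q p

/-- `(T,μ)` is a marked tree. An edge of `T` joins a node to its parent and is recorded by its
lower endpoint, so a set of edges is a set `μ` of non-root nodes. Each marked edge `{i,j}` is a
cadet edge, say with `i` the `s`-cadet of `j`, and if `s = 0` then `j < i`. -/
def IsMarking {m n : ℕ} (T : MTree m n) (μ : Set (Fin n)) : Prop :=
  ∀ i ∈ μ, ∃ j s, T.IsCadet i j s ∧ (s = 0 → j < i)

/-- The edge of `T` between `a` and `b` exists and is marked. -/
def MarkedEdge {m n : ℕ} (T : MTree m n) (μ : Set (Fin n)) (a b : Fin n) : Prop :=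
  (a ∈ μ ∧ ∃ s, T.IsChild a b s) ∨ (b ∈ μ ∧ ∃ s, T.IsChild b a s)

/-- The relation `i ∼_μ j`: the nodes are joined in `T` by a path of marked edges. -/
def simMu {m n : ℕ} (T : MTree m n) (μ : Set (Fin n)) : Fin n → Fin n → Prop :=
  Relation.ReflTransGen (MarkedEdge T μ)

/-- The set of blocks of a marked tree. -/
def blocksOf {m n : ℕ} (T : MTree m n) (μ : Set (Fin n)) : Set (Set (Fin n)) :=
  {B | ∃ i, B = {j | simMu T μ i j}}

/-- The block `B` is `A`-connected. -/
def BlockConnected {m n : ℕ} (A : Set (Set (Fin n → ℝ))) (T : MTree m n)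
    (B : Set (Fin n)) : Prop :=
  ∀ i ∈ B, ∀ j ∈ B, Relation.ReflTransGen
    (fun a b => a ∈ B ∧ b ∈ B ∧ hyp n a b ((T.drift a : ℝ) - (T.drift b : ℝ)) ∈ A) i j

/-- The marked tree `(T,μ)` is `A`-connected. -/
def AConnected {m n : ℕ} (A : Set (Set (Fin n → ℝ))) (T : MTree m n)
    (μ : Set (Fin n)) : Prop :=
  ∀ B ∈ blocksOf T μ, BlockConnected A T B

/-- The `A`-cadet condition. -/
def CadetCond {m n : ℕ} (A : Set (Set (Fin n → ℝ))) (T : MTree m n)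
    (μ : Set (Fin n)) : Prop :=
  ∀ i j s, T.IsCadet i j s → i ∉ μ →
    ((s = 0 ∧ i < j) ∨
      ∃ i' j', simMu T μ i' i ∧ simMu T μ j' j ∧
        hyp n i' j' ((T.drift i' : ℝ) - (T.drift j' : ℝ)) ∈ A)

/-- The set of all marked `(m,n)`-trees. -/
def OTall (m n : ℕ) : Set (MTree m n × Set (Fin n)) := {p | IsMarking p.1 p.2}

/-- The set of marked `(m,n)`-trees which are `A`-connected and satisfy the `A`-cadet
condition. -/
def OTset (m n : ℕ) (A : Set (Set (Fin n → ℝ))) : Set (MTree m n × Set (Fin n)) :=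
  {p | IsMarking p.1 p.2 ∧ AConnected A p.1 p.2 ∧ CadetCond A p.1 p.2}

/-- The polyhedron associated with a pair `(T,μ)` and the arrangement `A`. -/
def PhiBar (m n : ℕ) (A : Set (Set (Fin n → ℝ))) (p : MTree m n × Set (Fin n)) :
    Set (Fin n → ℝ) :=
  {x | (∀ i ∈ p.2, ∀ j s, p.1.IsChild i j s → x i - x j = (s : ℝ)) ∧
       (∀ i j : Fin n, ∀ s : ℕ, TrIdxA m n A i j s → ¬ simMu p.1 p.2 i j →
         vlt (p.1.path i) (p.1.path j ++ [s]) → x i - x j < (s : ℝ)) ∧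
       (∀ i j : Fin n, ∀ s : ℕ, TrIdxA m n A i j s → ¬ simMu p.1 p.2 i j →
         vge (p.1.path i) (p.1.path j ++ [s]) → (s : ℝ) < x i - x j)}

/-- `σ` is the hyperplane `H` itself or one of the two open half-spaces bounded by `H`. -/
def IsSideOf (n : ℕ) (σ H : Set (Fin n → ℝ)) : Prop :=
  σ = H ∨ ∃ (i j : Fin n) (s : ℝ), i ≠ j ∧ H = hyp n i j s ∧
    (σ = {x | x i - x j < s} ∨ σ = {x | s < x i - x j})

/-- `F` is a face of the arrangement `A`. -/
def IsFace (n : ℕ) (A : Set (Set (Fin n → ℝ))) (F : Set (Fin n → ℝ)) : Prop :=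
  F.Nonempty ∧ ∃ σ : Set (Fin n → ℝ) → Set (Fin n → ℝ),
    (∀ H ∈ A, IsSideOf n (σ H) H) ∧ F = ⋂ H ∈ A, σ H

/-- The codimension in `ℝ^n` of the affine hull of a subset. -/
noncomputable def codim (n : ℕ) (F : Set (Fin n → ℝ)) : ℕ :=
  Module.finrank ℝ ((Fin n → ℝ) ⧸ (affineSpan ℝ F).direction)

end Braid

namespace Braid

/-- The order on addresses in which a node precedes its descendants, and the subtree of a child
precedes the subtrees of the siblings to its left. -/
def pre : List ℕ → List ℕ → Prop
  | _, [] => False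
  | [], _ :: _ => True
  | a :: p, b :: q => b < a ∨ (a = b ∧ pre p q)

@[simp] theorem pre_nil_right (p : List ℕ) : ¬ pre p [] := by cases p <;> simp [pre]

@[simp] theorem pre_nil_cons (b : ℕ) (q : List ℕ) : pre [] (b :: q) := by simp [pre]

@[simp] theorem pre_cons_cons (a b : ℕ) (p q : List ℕ) :
    pre (a :: p) (b :: q) ↔ b < a ∨ (a = b ∧ pre p q) := by simp [pre]

theorem pre_irrefl (p : List ℕ) : ¬ pre p p := by
  induction p with
  | nil => simp
  | cons a p ih => simpa using ih

theorem pre_trans {p q r : List ℕ} (h₁ : pre p q) (h₂ : pre q r) : pre p r := by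
  induction p generalizing q r with
  | nil => cases r <;> simp_all
  | cons a p ih =>
    cases q with
    | nil => simp at h₁
    | cons b q =>
      cases r with
      | nil => simp at h₂
      | cons c r =>
        simp only [pre_cons_cons] at h₁ h₂ ⊢
        rcases h₁ with h₁ | ⟨rfl, h₁⟩ <;> rcases h₂ with h₂ | ⟨rfl, h₂⟩
        · left; omega
        · left; omega
        · left; omega
        · exact Or.inr ⟨rfl, ih h₁ h₂⟩

theorem pre_asymm {p q : List ℕ} (h₁ : pre p q) : ¬ pre q p :=
  fun h₂ => pre_irrefl p (pre_trans h₁ h₂)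

theorem pre_trichotomy (p q : List ℕ) : pre p q ∨ p = q ∨ pre q p := by
  induction p generalizing q with
  | nil => cases q <;> simp
  | cons a p ih =>
    cases q with
    | nil => simp
    | cons b q =>
      simp only [pre_cons_cons, List.cons.injEq]
      have := ih q
      rcases lt_trichotomy a b with h | h | h
      · tauto
      · subst h; tauto
      · tauto

theorem pre_append (p : List ℕ) {q : List ℕ} (hq : q ≠ []) : pre p (p ++ q) := by
  induction p with
  | nil => cases q <;> simp_all
  | cons a p ih => simpa using ih

/-- An address which comes after `p` but not after `p ++ [s]` lies in the subtree of a `c`-child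
of `p`, where `s ≤ c`. -/
theorem exists_of_pre_between {p q : List ℕ} {s : ℕ} (h : pre p q)
    (h' : ¬ pre (p ++ [s]) q) : ∃ c r, q = p ++ c :: r ∧ s ≤ c ∧ (c = s → r = []) := by
  induction p generalizing q with
  | nil =>
    cases q with
    | nil => simp at h
    | cons c r =>
      refine ⟨c, r, rfl, ?_⟩
      simp only [List.nil_append, pre_cons_cons, not_or, not_and, not_lt] at h'
      refine ⟨h'.1, fun hc => ?_⟩
      have := h'.2 hc.symm
      cases r <;> simp_all
  | cons a p ih =>
    cases q with
    | nil => simp at h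
    | cons b q =>
      simp only [List.cons_append, pre_cons_cons, not_or, not_and, not_lt] at h h'
      have hab : a = b := by
        rcases h with h | h
        · omega
        · exact h.1
      subst hab
      simp only [lt_irrefl, true_and, false_or] at h
      obtain ⟨c, r, hq, hc⟩ := ih h (h'.2 rfl)
      exact ⟨c, r, by simp [hq], hc⟩

theorem pre_append_singleton_iff {p q : List ℕ} {s : ℕ} (hne : p ≠ q)
    (hs : p.sum = q.sum + s) : pre p (q ++ [s]) ↔ pre p q := by
  induction p generalizing q with
  | nil => cases q <;> simp_all
  | cons a p ih =>
    cases q with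
    | nil => simp at hs ⊢; omega
    | cons b q =>
      simp only [List.cons_append, pre_cons_cons]
      by_cases hab : a = b
      · subst hab
        rw [ih (by simpa using hne) (by simp at hs; omega)]
      · simp [hab]

theorem pre_iff_take {p q : List ℕ} : pre p q ↔ p ≠ q ∧ ∃ c ≤ p.length, p.take c = q.take c ∧
    (c = p.length ∨ ∃ (_ : c < p.length) (_ : c < q.length), q[c] < p[c]) := by
  induction p generalizing q with
  | nil => cases q <;> simp
  | cons a p ih =>
    cases q with
    | nil => simp
    | cons b q =>
      rw [pre_cons_cons, ih]
      constructor
      · rintro (h | ⟨rfl, hne, c, hc, ht, h⟩)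
        · exact ⟨by rintro ⟨⟩; exact lt_irrefl _ h, 0, by simp, by simp, Or.inr ⟨by simp, by simp, by simpa⟩⟩
        · refine ⟨by simpa using hne, c + 1, by simpa using hc, by simpa using ht, ?_⟩
          simpa using h
      · rintro ⟨hne, c, hc, ht, h⟩
        cases c with
        | zero => left; simpa using h
        | succ c =>
          simp only [List.take_succ_cons, List.cons.injEq] at ht
          obtain ⟨rfl, ht⟩ := ht
          right
          refine ⟨rfl, by simpa using hne, c, by simpa using hc, ht, by simpa using h⟩

theorem vlt_iff {p q : List ℕ} : vlt p q ↔ p.sum < q.sum ∨ (p.sum = q.sum ∧ pre p q) := by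
  rw [pre_iff_take, vlt]
  constructor
  · rintro ⟨hne, h | ⟨h, h'⟩⟩
    · exact Or.inl h
    · exact Or.inr ⟨h, hne, h'⟩
  · rintro (h | ⟨h, hne, h'⟩)
    · exact ⟨by rintro rfl; exact lt_irrefl _ h, Or.inl h⟩
    · exact ⟨hne, Or.inr ⟨h, h'⟩⟩

theorem vge_iff_not_vlt {p q : List ℕ} : vge p q ↔ ¬ vlt p q := by
  rw [vge, vlt_iff, vlt_iff]
  constructor
  · rintro (rfl | h | ⟨h, h'⟩)
    · simp [pre_irrefl]
    · omega
    · rintro (h'' | ⟨_, h''⟩)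
      · omega
      · exact pre_asymm h' h''
  · intro h
    have := pre_trichotomy p q
    rcases lt_trichotomy p.sum q.sum with h1 | h1 | h1
    · tauto
    · simp only [h1, lt_irrefl, true_and, false_or] at h ⊢
      tauto
    · tauto

theorem vlt_append_singleton_iff {p q : List ℕ} {s : ℕ} (hne : p ≠ q) :
    vlt p (q ++ [s]) ↔ p.sum < q.sum + s ∨ (p.sum = q.sum + s ∧ pre p q) := by
  rw [vlt_iff, List.sum_append, List.sum_singleton]
  by_cases h : p.sum = q.sum + s
  · rw [pre_append_singleton_iff hne h]
  · simp [h]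

namespace MTree

variable {m n : ℕ} {T : MTree m n} {i j k : Fin n} {s t : ℕ}

theorem exists_path_eq_of_append {v : Fin n} {p : List ℕ} (q : List ℕ) (h : T.path v = p ++ q) :
    ∃ w, T.path w = p := by
  induction q using List.reverseRecOn generalizing v with
  | nil => exact ⟨v, by simpa using h⟩
  | append_singleton q a ih =>
    obtain ⟨w, hw⟩ := T.parent_closed v (by simp [h])
    exact ih (v := w) (by rw [hw, h, ← List.append_assoc, List.dropLast_concat])

theorem IsChild.drift_eq (h : T.IsChild i j s) : T.drift i = T.drift j + s := by
  rw [IsChild] at h; simp [drift, h]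

theorem IsChild.le (h : T.IsChild i j s) : s ≤ m :=
  T.entry_le i s (by rw [IsChild] at h; simp [h])

theorem IsChild.pre_path (h : T.IsChild i j s) : pre (T.path j) (T.path i) := by
  rw [IsChild] at h; rw [h]; exact pre_append _ (by simp)

theorem IsChild.ne (h : T.IsChild i j s) : i ≠ j := by
  rintro rfl; exact pre_irrefl _ h.pre_path

theorem IsChild.unique (h : T.IsChild i j s) (h' : T.IsChild i k t) : j = k ∧ s = t := by
  rw [IsChild] at h h'
  obtain ⟨h1, h2⟩ := List.append_inj' (h.symm.trans h') rfl
  exact ⟨T.inj h1, by simpa using h2⟩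

theorem IsCadet.unique (h : T.IsCadet i j s) (h' : T.IsCadet k j t) : i = k := by
  have hst : s = t := by
    by_contra hne
    rcases lt_or_gt_of_ne hne with hlt | hlt
    · exact h.2 t hlt h'.1.le ⟨_, h'.1⟩
    · exact h'.2 s hlt h.1.le ⟨_, h.1⟩
  subst hst
  exact T.inj (h.1.trans h'.1.symm)

theorem exists_isChild (h : T.path i ≠ []) : ∃ j s, T.IsChild i j s := by
  obtain ⟨w, hw⟩ := T.parent_closed i h
  exact ⟨w, (T.path i).getLast h, by rw [IsChild, hw, List.dropLast_append_getLast]⟩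

/-- No node comes strictly between a node and its cadet. -/
theorem IsCadet.eq_of_between (h : T.IsCadet i j s) (h₁ : pre (T.path j) (T.path k))
    (h₂ : ¬ pre (T.path i) (T.path k)) : k = i := by
  have hp : T.path i = T.path j ++ [s] := h.1
  rw [hp] at h₂
  obtain ⟨c, r, hk, hsc, hr⟩ := exists_of_pre_between h₁ h₂
  rcases hsc.eq_or_lt with rfl | hlt
  · exact T.inj (by rw [hk, hp, hr rfl])
  · exfalso
    obtain ⟨w, hw⟩ := exists_path_eq_of_append (T := T) (v := k) (p := T.path j ++ [c]) r
      (by simpa using hk)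
    exact h.2 c hlt (T.entry_le k c (by simp [hk])) ⟨w, hw⟩

/-- The order of the points `drift j + s` induced by the tree, ties being broken by `pre`. -/
def tlt (T : MTree m n) (j : Fin n) (s : ℕ) (k : Fin n) (t : ℕ) : Prop :=
  T.drift j + s < T.drift k + t ∨ (T.drift j + s = T.drift k + t ∧ pre (T.path j) (T.path k))

theorem vlt_path_iff (h : i ≠ j) : vlt (T.path i) (T.path j ++ [s]) ↔ T.tlt i 0 j s :=
  vlt_append_singleton_iff (fun e => h (T.inj e))

theorem tlt_add_right (u : ℕ) : T.tlt i (s + u) j (t + u) ↔ T.tlt i s j t := by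
  simp only [tlt, ← add_assoc, Nat.add_lt_add_iff_right, Nat.add_right_cancel_iff]

theorem tlt_self_iff : T.tlt i s i t ↔ s < t := by
  simp [tlt, pre_irrefl]

theorem not_tlt_iff (h : i ≠ j) : ¬ T.tlt i s j t ↔ T.tlt j t i s := by
  simp only [tlt]
  have h1 := pre_trichotomy (T.path i) (T.path j)
  have h2 : T.path i ≠ T.path j := fun e => h (T.inj e)
  have h3 := @pre_asymm (T.path i) (T.path j)
  rcases lt_trichotomy (T.drift i + s) (T.drift j + t) with h | h | h
  · simp [h, h.not_gt, h.ne']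
  · simp only [h, lt_irrefl, true_and, false_or]; tauto
  · simp [h, h.not_gt, h.ne']

theorem tlt_asymm (h : T.tlt i s j t) : ¬ T.tlt j t i s := by
  by_cases hij : i = j
  · subst hij; rw [tlt_self_iff] at *; omega
  · rw [not_tlt_iff (Ne.symm hij)]; exact h

theorem tlt_trans {u : ℕ} (h₁ : T.tlt i s j t) (h₂ : T.tlt j t k u) : T.tlt i s k u := by
  rcases h₁ with h₁ | ⟨h₁, h₁'⟩ <;> rcases h₂ with h₂ | ⟨h₂, h₂'⟩
  · exact Or.inl (by omega)
  · exact Or.inl (by omega)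
  · exact Or.inl (by omega)
  · exact Or.inr ⟨by omega, pre_trans h₁' h₂'⟩

theorem tlt_trichotomy (T : MTree m n) (i : Fin n) (s : ℕ) (j : Fin n) (t : ℕ) :
    T.tlt i s j t ∨ (i = j ∧ s = t) ∨ T.tlt j t i s := by
  by_cases hij : i = j
  · subst hij; simp only [tlt_self_iff, true_and]; omega
  · by_cases h : T.tlt i s j t
    · exact Or.inl h
    · exact Or.inr (Or.inr ((not_tlt_iff hij).1 h))

theorem path_ne_nil_of_tlt (h : T.tlt j s i 0) : T.path i ≠ [] := by
  intro hi
  rcases h with h | ⟨_, h⟩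
  · simp [drift, hi] at h
  · simp [hi] at h

theorem IsChild.tlt (h : T.IsChild i j s) : T.tlt j s i 0 :=
  Or.inr ⟨by simp [h.drift_eq], h.pre_path⟩

/-- The position of a node immediately follows the point of its parent. -/
theorem IsChild.not_tlt_of_tlt (h : T.IsChild i j s) (hk : T.tlt k t i 0) : ¬ T.tlt j s k t := by
  rintro (hlt | ⟨heq, hpre⟩)
  · have hd := h.drift_eq
    rcases hk with hk | ⟨hk, -⟩ <;> omega
  · have hd := h.drift_eq
    have hki : pre (T.path k) (T.path i) := by
      rcases hk with hk | hk
      · omega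
      · exact hk.2
    have hp : T.path i = T.path j ++ [s] := h
    obtain ⟨c, r, hk', hsc, hr⟩ := exists_of_pre_between hpre (s := s)
      (by rw [← hp]; exact pre_asymm hki)
    rcases hsc.eq_or_lt with rfl | hlt
    · rw [hr rfl, ← hp] at hk'
      rw [hk'] at hki
      exact pre_irrefl _ hki
    · have : T.drift k = T.drift j + c + r.sum := by simp [drift, hk', add_assoc]
      omega

end MTree

open MTree

/-- The key by which the points `x j + s` are ordered, ties being broken by `x j` and then by
`j`. -/
noncomputable def key {n : ℕ} (x : Fin n → ℝ) (j : Fin n) (s : ℕ) : ℝ ×ₗ ℝ ×ₗ Fin n :=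
  toLex (x j + s, toLex (x j, j))

section Key

variable {m n : ℕ} {x : Fin n → ℝ} {i j k : Fin n} {s t : ℕ}

theorem key_lt_iff : key x j s < key x k t ↔ x j + s < x k + t ∨
    (x j + s = x k + t ∧ (x j < x k ∨ (x j = x k ∧ j < k))) := by
  simp [key, Prod.Lex.toLex_lt_toLex]

theorem key_eq_iff : key x j s = key x k t ↔ j = k ∧ s = t := by
  constructor
  · intro h
    simp only [key, EmbeddingLike.apply_eq_iff_eq, Prod.mk.injEq] at h
    obtain ⟨h1, -, rfl⟩ := h
    exact ⟨rfl, by exact_mod_cast add_left_cancel h1⟩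
  · rintro ⟨rfl, rfl⟩; rfl

theorem key_lt_self_iff : key x j s < key x j t ↔ s < t := by
  simp [key_lt_iff]

theorem key_lt_add_right_iff (u : ℕ) : key x j (s + u) < key x k (t + u) ↔
    key x j s < key x k t := by
  simp [key_lt_iff, ← add_assoc]

theorem key_zero_le : key x j 0 ≤ key x j s := by
  rcases Nat.eq_zero_or_pos s with rfl | h
  · exact le_rfl
  · exact (key_lt_self_iff.2 h).le

/-- The number of indices that precede `i` in the order given by `x`. -/
noncomputable def xrank {n : ℕ} (x : Fin n → ℝ) (i : Fin n) : ℕ :=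
  (Finset.univ.filter fun l => key x l 0 < key x i 0).card

theorem xrank_lt (h : key x j s < key x i 0) : xrank x j < xrank x i := by
  have hji : key x j 0 < key x i 0 := key_zero_le.trans_lt h
  refine Finset.card_lt_card ((Finset.ssubset_iff_of_subset ?_).2 ⟨j, ?_, ?_⟩)
  · intro l hl
    simp only [Finset.mem_filter, Finset.mem_univ, true_and] at hl ⊢
    exact hl.trans hji
  · simpa using hji
  · simp

/-- The point `x j + s` immediately precedes `x i` among the points `x k + t`, `t ≤ m`. -/
def IsPar (m : ℕ) {n : ℕ} (x : Fin n → ℝ) (j : Fin n) (s : ℕ) (i : Fin n) : Prop :=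
  s ≤ m ∧ key x j s < key x i 0 ∧
    ∀ k t, t ≤ m → key x k t < key x i 0 → key x k t ≤ key x j s

theorem IsPar.unique (h : IsPar m x j s i) (h' : IsPar m x k t i) : j = k ∧ s = t :=
  key_eq_iff.1 (le_antisymm (h'.2.2 _ _ h.1 h.2.1) (h.2.2 _ _ h'.1 h'.2.1))

theorem exists_isPar (hs : s ≤ m) (h : key x j s < key x i 0) : ∃ k t, IsPar m x k t i := by
  classical
  obtain ⟨⟨k, t⟩, hk, hmax⟩ := Finset.exists_max_image
    ((Finset.univ ×ˢ Finset.range (m + 1)).filter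
      fun q : Fin n × ℕ => key x q.1 q.2 < key x i 0) (fun q => key x q.1 q.2)
    ⟨(j, s), by simp [h]; omega⟩
  simp only [Finset.mem_filter, Finset.mem_product, Finset.mem_univ, true_and,
    Finset.mem_range] at hk hmax
  exact ⟨k, t, by omega, hk.2, fun l u hu hl => hmax (l, u) ⟨by simp; omega, hl⟩⟩

open Classical in
/-- The address of the node `i` in the tree associated with `x`. -/
noncomputable def bpath (m : ℕ) {n : ℕ} (x : Fin n → ℝ) (i : Fin n) : List ℕ :=
  if h : ∃ q : Fin n × ℕ, IsPar m x q.1 q.2 i then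
    bpath m x h.choose.1 ++ [h.choose.2]
  else []
termination_by xrank x i
decreasing_by exact xrank_lt h.choose_spec.2.1

theorem IsPar.bpath_eq (h : IsPar m x j s i) : bpath m x i = bpath m x j ++ [s] := by
  have hex : ∃ q : Fin n × ℕ, IsPar m x q.1 q.2 i := ⟨(j, s), h⟩
  rw [bpath, dif_pos hex]
  obtain ⟨h1, h2⟩ := hex.choose_spec.unique h
  rw [h1, h2]

theorem bpath_eq_nil (h : ∀ j s, ¬ IsPar m x j s i) : bpath m x i = [] := by
  rw [bpath, dif_neg]
  rintro ⟨q, hq⟩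
  exact h _ _ hq

theorem bpath_cases (m : ℕ) (x : Fin n → ℝ) (i : Fin n) :
    (∃ j s, IsPar m x j s i ∧ bpath m x i = bpath m x j ++ [s]) ∨
    ((∀ j s, s ≤ m → ¬ key x j s < key x i 0) ∧ bpath m x i = []) := by
  by_cases h : ∃ j s, IsPar m x j s i
  · obtain ⟨j, s, h⟩ := h
    exact Or.inl ⟨j, s, h, h.bpath_eq⟩
  · push Not at h
    refine Or.inr ⟨fun j s hs hlt => ?_, bpath_eq_nil h⟩
    obtain ⟨k, t, hk⟩ := exists_isPar hs hlt
    exact h k t hk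

theorem eq_of_bpath_eq {i' : Fin n} (h : bpath m x i = bpath m x i') : i = i' := by
  by_contra hne
  have hne' : key x i 0 ≠ key x i' 0 := fun e => hne (key_eq_iff.1 e).1
  induction hN : xrank x i using Nat.strong_induction_on generalizing i i' with
  | _ N ih =>
  rcases bpath_cases m x i with ⟨j, s, hj, hji⟩ | ⟨hi, hnil⟩ <;>
  rcases bpath_cases m x i' with ⟨j', s', hj', hji'⟩ | ⟨hi', hnil'⟩
  · rw [hji, hji'] at h
    obtain ⟨h1, h2⟩ := List.append_inj' h rfl
    have hs : s = s' := by simpa using h2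
    have hjj : j = j' := by
      by_contra hjj
      exact ih _ (hN ▸ xrank_lt hj.2.1) h1 hjj (fun e => hjj (key_eq_iff.1 e).1) rfl
    subst hs hjj
    rcases lt_or_gt_of_ne hne' with hlt | hlt
    · exact (hj'.2.2 i 0 (Nat.zero_le _) hlt).not_gt hj.2.1
    · exact (hj.2.2 i' 0 (Nat.zero_le _) hlt).not_gt hj'.2.1
  · simp [hji, hnil'] at h
  · simp [hji', hnil] at h
  · rcases lt_or_gt_of_ne hne' with hlt | hlt
    · exact hi' _ _ (Nat.zero_le _) hlt
    · exact hi _ _ (Nat.zero_le _) hlt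

theorem le_of_mem_bpath (i : Fin n) : ∀ s ∈ bpath m x i, s ≤ m := by
  induction hN : xrank x i using Nat.strong_induction_on generalizing i with
  | _ N ih =>
  rcases bpath_cases m x i with ⟨j, s, hj, hji⟩ | ⟨-, hnil⟩
  · intro t ht
    rw [hji, List.mem_append, List.mem_singleton] at ht
    rcases ht with ht | rfl
    · exact ih _ (hN ▸ xrank_lt hj.2.1) j rfl t ht
    · exact hj.1
  · simp [hnil]

/-- The tree associated with a point `x`. -/
noncomputable def treeOf (m : ℕ) {n : ℕ} (x : Fin n → ℝ) : MTree m n where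
  path := bpath m x
  entry_le := le_of_mem_bpath
  inj := fun _ _ h => eq_of_bpath_eq h
  parent_closed := by
    intro v hv
    rcases bpath_cases m x v with ⟨j, s, -, hj⟩ | ⟨-, hnil⟩
    · exact ⟨j, by rw [hj, List.dropLast_concat]⟩
    · exact absurd hnil hv

theorem IsPar.isChild (h : IsPar m x j s i) : (treeOf m x).IsChild i j s := h.bpath_eq

theorem tlt_treeOf_of_key_lt (hs : s ≤ m) (ht : t ≤ m) (h : key x j s < key x k t) :
    (treeOf m x).tlt j s k t := by
  induction hN : xrank x j + xrank x k using Nat.strong_induction_on generalizing j k s t with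
  | _ N ih =>
  have key_case : ∀ s, s ≤ m → key x j s < key x k 0 → (treeOf m x).tlt j s k 0 := by
    intro s hs h
    obtain ⟨l, u, hl⟩ := exists_isPar hs h
    rcases (hl.2.2 _ _ hs h).eq_or_lt with heq | hlt
    · obtain ⟨rfl, rfl⟩ := key_eq_iff.1 heq
      exact hl.isChild.tlt
    · exact tlt_trans (ih _ (by have := xrank_lt hl.2.1; omega) hs hl.1 hlt rfl) hl.isChild.tlt
  rcases le_or_gt t s with hts | hst
  · obtain ⟨u, rfl⟩ := Nat.exists_eq_add_of_le' hts
    have h' : key x j u < key x k 0 := (key_lt_add_right_iff t).1 (by rwa [zero_add])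
    have := (tlt_add_right t).2 (key_case u (by omega) h')
    rwa [zero_add] at this
  · obtain ⟨u, rfl⟩ := Nat.exists_eq_add_of_lt hst
    have e : s + u + 1 = (u + 1) + s := by omega
    rw [e] at h ⊢
    replace h : key x j 0 < key x k (u + 1) := (key_lt_add_right_iff s).1 (by rwa [zero_add])
    suffices hsuff : (treeOf m x).tlt j 0 k (u + 1) by
      have := (tlt_add_right s).2 hsuff
      rwa [zero_add] at this
    rcases lt_trichotomy (key x j 0) (key x k 0) with hjk | hjk | hjk
    · exact tlt_trans (key_case 0 (Nat.zero_le _) hjk) (tlt_self_iff.2 (by omega))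
    · obtain ⟨rfl, -⟩ := key_eq_iff.1 hjk
      exact tlt_self_iff.2 (by omega)
    · obtain ⟨l, v, hl⟩ := exists_isPar (Nat.zero_le m) hjk
      have hlk : (treeOf m x).tlt l v k (u + 1) :=
        ih _ (by have := xrank_lt hl.2.1; omega) hl.1 (by omega) (hl.2.1.trans h) rfl
      by_contra hcon
      rw [not_tlt_iff (by rintro rfl; exact lt_irrefl _ hjk)] at hcon
      exact hl.isChild.not_tlt_of_tlt hcon hlk

/-- The tree `T` and the point `x` order the points `(j, s)`, `s ≤ m`, in the same way. -/
def Matches {m n : ℕ} (T : MTree m n) (x : Fin n → ℝ) : Prop :=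
  ∀ j k s t, s ≤ m → t ≤ m → (T.tlt j s k t ↔ key x j s < key x k t)

theorem matches_treeOf (m : ℕ) (x : Fin n → ℝ) : Matches (treeOf m x) x := by
  intro j k s t hs ht
  refine ⟨fun h => ?_, tlt_treeOf_of_key_lt hs ht⟩
  rcases lt_trichotomy (key x j s) (key x k t) with h' | h' | h'
  · exact h'
  · obtain ⟨rfl, rfl⟩ := key_eq_iff.1 h'
    exact absurd (tlt_self_iff.1 h) (lt_irrefl _)
  · exact absurd h (tlt_asymm (tlt_treeOf_of_key_lt ht hs h'))

theorem Matches.eq {T T' : MTree m n} (h : Matches T x) (h' : Matches T' x) : T = T' := by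
  have hTT : ∀ j k s t, s ≤ m → t ≤ m → (T.tlt j s k t ↔ T'.tlt j s k t) :=
    fun j k s t hs ht => (h j k s t hs ht).trans (h' j k s t hs ht).symm
  have main : ∀ N i, (T.path i).length = N → T.path i = T'.path i := by
    intro N
    induction N with
    | zero =>
      intro i hi
      rw [List.length_eq_zero_iff] at hi
      by_contra hne
      obtain ⟨j, s, hj⟩ := exists_isChild (T := T') (i := i) (fun e => hne (hi.trans e.symm))
      exact path_ne_nil_of_tlt ((hTT j i s 0 hj.le (Nat.zero_le _)).2 hj.tlt) hi
    | succ N ih =>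
      intro i hi
      obtain ⟨j, s, hj⟩ := exists_isChild (T := T) (i := i) (by rintro e; simp [e] at hi)
      have h1 := (hTT j i s 0 hj.le (Nat.zero_le _)).1 hj.tlt
      obtain ⟨j', s', hj'⟩ := exists_isChild (path_ne_nil_of_tlt h1)
      have h2 := (hTT j' i s' 0 hj'.le (Nat.zero_le _)).2 hj'.tlt
      have h3 := hj.not_tlt_of_tlt h2
      have h4 := hj'.not_tlt_of_tlt h1
      rw [← hTT _ _ _ _ hj'.le hj.le] at h4
      obtain ⟨rfl, rfl⟩ : j = j' ∧ s = s' := by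
        rcases T.tlt_trichotomy j s j' s' with h | h | h
        · exact absurd h h3
        · exact h
        · exact absurd h h4
      have e : T.path i = T.path j ++ [s] := hj
      have e' : T'.path i = T'.path j ++ [s] := hj'
      rw [e, e', ih j (by rw [e] at hi; simpa using hi)]
  exact MTree.ext (funext fun i => main _ i rfl)

end Key

section Blocks

variable {m n : ℕ} {T : MTree m n} {μ : Set (Fin n)} {x : Fin n → ℝ} {i j k u w : Fin n} {s t : ℕ}

theorem MarkedEdge.symm (h : MarkedEdge T μ i j) : MarkedEdge T μ j i := Or.symm h

theorem simMu_symm (h : simMu T μ i j) : simMu T μ j i := by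
  induction h with
  | refl => exact .refl
  | tail _ hbc ih => exact .head hbc.symm ih

/-- The node `w` is reached from `u` by descending along marked edges. -/
def Down (T : MTree m n) (μ : Set (Fin n)) : Fin n → Fin n → Prop :=
  Relation.ReflTransGen fun a b => b ∈ μ ∧ ∃ s, T.IsChild b a s

theorem Down.simMu (h : Down T μ u w) : simMu T μ u w :=
  Relation.ReflTransGen.mono (fun _ _ hab => Or.inr hab) _ _ h

theorem Down.eq_or_pre (h : Down T μ u w) : u = w ∨ pre (T.path u) (T.path w) := by
  induction h with
  | refl => exact Or.inl rfl
  | tail _ hbc ih =>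
    obtain ⟨-, s, hs⟩ := hbc
    rcases ih with rfl | ih
    · exact Or.inr hs.pre_path
    · exact Or.inr (pre_trans ih hs.pre_path)

theorem IsMarking.isCadet (hμ : IsMarking T μ) (hi : i ∈ μ) (h : T.IsChild i j s) :
    T.IsCadet i j s ∧ (s = 0 → j < i) := by
  obtain ⟨j', s', h1, h2⟩ := hμ i hi
  obtain ⟨rfl, rfl⟩ := h.unique h1.1
  exact ⟨h1, h2⟩

/-- The blocks of a marked tree are descending chains. -/
theorem IsMarking.down_or_down (hμ : IsMarking T μ) (h : simMu T μ i j) :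
    Down T μ i j ∨ Down T μ j i := by
  induction h with
  | refl => exact Or.inl .refl
  | @tail a b _ hab ih =>
    rcases hab with ⟨ha, s, hs⟩ | ⟨hb, s, hs⟩
    · rcases ih with ih | ih
      · rcases Relation.ReflTransGen.cases_tail ih with rfl | ⟨c, hc, -, t, ht⟩
        · exact Or.inr (.single ⟨ha, s, hs⟩)
        · obtain ⟨rfl, -⟩ := hs.unique ht
          exact Or.inl hc
      · exact Or.inr (.head ⟨ha, s, hs⟩ ih)
    · rcases ih with ih | ih
      · exact Or.inl (.tail ih ⟨hb, s, hs⟩)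
      · rcases Relation.ReflTransGen.cases_head ih with rfl | ⟨c, ⟨hc, t, ht⟩, hci⟩
        · exact Or.inl (.single ⟨hb, s, hs⟩)
        · obtain rfl := (hμ.isCadet hb hs).1.unique (hμ.isCadet hc ht).1
          exact Or.inr hci

theorem IsMarking.mem_of_simMu (hμ : IsMarking T μ) (h : T.IsChild i j s)
    (hs : simMu T μ i j) : i ∈ μ := by
  rcases hμ.down_or_down hs with hd | hd
  · rcases hd.eq_or_pre with rfl | hp
    · exact absurd rfl h.ne
    · exact absurd hp (pre_asymm h.pre_path)
  · rcases Relation.ReflTransGen.cases_tail hd with rfl | ⟨c, -, hc, -⟩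
    · exact absurd rfl h.ne
    · exact hc

theorem exists_down_not_mem (hμ : IsMarking T μ) (j : Fin n) : ∃ k, k ∉ μ ∧ Down T μ k j := by
  induction hN : (T.path j).length using Nat.strong_induction_on generalizing j with
  | _ N ih =>
  by_cases hj : j ∈ μ
  · obtain ⟨i, s, hi, -⟩ := hμ j hj
    have hp : T.path j = T.path i ++ [s] := hi.1
    obtain ⟨k, hk, hki⟩ := ih _ (by rw [← hN, hp]; simp) i rfl
    exact ⟨k, hk, hki.tail ⟨hj, s, hi.1⟩⟩
  · exact ⟨j, hj, .refl⟩

/-- The blocks are intervals in the order `pre`. -/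
theorem IsMarking.simMu_of_between (hμ : IsMarking T μ) (h : Down T μ k j)
    (h₁ : ¬ pre (T.path i) (T.path k)) (h₂ : ¬ pre (T.path j) (T.path i)) : simMu T μ i k := by
  induction h with
  | refl =>
    rcases pre_trichotomy (T.path i) (T.path k) with h | h | h
    · exact absurd h h₁
    · rw [T.inj h]; exact .refl
    · exact absurd h h₂
  | @tail b c hkb hbc ih =>
    by_cases hb : pre (T.path b) (T.path i)
    · obtain ⟨hc, s, hs⟩ := id hbc
      rw [(hμ.isCadet hc hs).1.eq_of_between hb h₂]
      exact simMu_symm (Down.simMu (hkb.tail hbc))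
    · exact ih hb

theorem hyp_mem_catArr {s : ℤ} (h : i ≠ j) (h₁ : -(m : ℤ) ≤ s) (h₂ : s ≤ m) :
    hyp n i j (s : ℝ) ∈ catArr m n := by
  rcases lt_or_gt_of_ne h with hij | hij
  · exact ⟨i, j, s, hij, h₁, h₂, rfl⟩
  · refine ⟨j, i, -s, hij, by omega, by omega, ?_⟩
    ext x
    simp only [hyp, Set.mem_ofPred_eq]
    push_cast
    constructor <;> intro h <;> linarith

theorem hyp_natCast_mem_catArr (h : i ≠ j) (hs : s ≤ m) : hyp n i j (s : ℝ) ∈ catArr m n := by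
  have := hyp_mem_catArr (m := m) (s := (s : ℤ)) h (by omega) (by omega)
  simpa using this

theorem mem_PhiBar_iff : x ∈ PhiBar m n (catArr m n) (T, μ) ↔
    (∀ i ∈ μ, ∀ j s, T.IsChild i j s → x i - x j = (s : ℝ)) ∧
    ∀ i j s, TrIdx m n i j s → ¬ simMu T μ i j →
      (T.tlt i 0 j s → x i - x j < s) ∧ (T.tlt j s i 0 → s < x i - x j) := by
  simp only [PhiBar, Set.mem_ofPred_eq]
  refine and_congr Iff.rfl ⟨fun h i j s hT hs => ?_, fun h => ⟨fun i j s hT hs hv => ?_,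
    fun i j s hT hs hv => ?_⟩⟩
  · have hA : TrIdxA m n (catArr m n) i j s := ⟨hT, hyp_natCast_mem_catArr hT.2.1 hT.1⟩
    refine ⟨fun ht => h.1 i j s hA hs ((vlt_path_iff hT.2.1).2 ht), fun ht => h.2 i j s hA hs ?_⟩
    rw [vge_iff_not_vlt, vlt_path_iff hT.2.1]
    exact tlt_asymm ht
  · exact (h i j s hT.1 hs).1 ((vlt_path_iff hT.1.2.1).1 hv)
  · rw [vge_iff_not_vlt, vlt_path_iff hT.1.2.1, not_tlt_iff hT.1.2.1] at hv
    exact (h i j s hT.1 hs).2 hv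

theorem sub_eq_drift_of_simMu
    (hx : ∀ i ∈ μ, ∀ j s, T.IsChild i j s → x i - x j = (s : ℝ)) (h : simMu T μ i j) :
    x i - x j = (T.drift i : ℝ) - T.drift j := by
  induction h with
  | refl => simp
  | tail _ hbc ih =>
    rcases hbc with ⟨hb, s, hs⟩ | ⟨hb, s, hs⟩ <;>
    · have h1 := hx _ hb _ s hs
      have h2 := congrArg (Nat.cast : ℕ → ℝ) hs.drift_eq
      push_cast at h2
      linarith

theorem IsMarking.lt_or_of_down (hμ : IsMarking T μ)
    (hx : ∀ i ∈ μ, ∀ j s, T.IsChild i j s → x i - x j = (s : ℝ)) (h : Down T μ u w) :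
    u = w ∨ x u < x w ∨ (x u = x w ∧ u < w) := by
  induction h with
  | refl => exact Or.inl rfl
  | @tail b c _ hbc ih =>
    right
    obtain ⟨hc, s, hs⟩ := hbc
    have h1 := hx c hc b s hs
    have h2 : x b < x c ∨ (x b = x c ∧ b < c) := by
      rcases Nat.eq_zero_or_pos s with rfl | hpos
      · exact Or.inr ⟨by push_cast at h1; linarith, (hμ.isCadet hc hs).2 rfl⟩
      · have : (0 : ℝ) < s := by exact_mod_cast hpos
        exact Or.inl (by linarith)
    rcases ih with rfl | h3 | ⟨h3, h3'⟩
    · exact h2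
    · rcases h2 with h2 | h2 <;> exact Or.inl (by linarith)
    · rcases h2 with h2 | ⟨h2, h2'⟩
      · exact Or.inl (by linarith)
      · exact Or.inr ⟨by linarith, h3'.trans h2'⟩

theorem tlt_iff_of_down (hμ : IsMarking T μ)
    (hx : ∀ i ∈ μ, ∀ j s, T.IsChild i j s → x i - x j = (s : ℝ)) (h : Down T μ u w)
    (hne : u ≠ w) : T.tlt u s w t ↔ key x u s < key x w t := by
  have h1 := (hμ.lt_or_of_down hx h).resolve_left hne
  have h2 := h.eq_or_pre.resolve_left hne
  have h3 := sub_eq_drift_of_simMu hx h.simMu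
  rw [key_lt_iff, tlt]
  simp only [h1, h2, and_true]
  rw [← le_iff_lt_or_eq, ← le_iff_lt_or_eq]
  rw [← Nat.cast_le (α := ℝ)]
  push_cast
  constructor <;> intro h <;> linarith

/-- The tree determines the side of each hyperplane not containing the polyhedron. -/
theorem sub_lt_and_lt_sub_of_mem (h : x ∈ PhiBar m n (catArr m n) (T, μ)) (hne : i ≠ j)
    (hs : s ≤ m) (hsim : ¬ simMu T μ i j) :
    (T.tlt i 0 j s → x i - x j < s) ∧ (T.tlt j s i 0 → s < x i - x j) := by
  have hx' := (mem_PhiBar_iff.1 h).2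
  rcases Nat.eq_zero_or_pos s with rfl | hpos
  · rcases lt_or_gt_of_ne hne with hij | hij
    · have := hx' j i 0 ⟨hs, hne.symm, Or.inr hij⟩ (fun h => hsim (simMu_symm h))
      push_cast at *
      exact ⟨fun h => by linarith [this.2 h], fun h => by linarith [this.1 h]⟩
    · exact hx' i j 0 ⟨hs, hne, Or.inr hij⟩ hsim
  · exact hx' i j s ⟨hs, hne, Or.inl hpos⟩ hsim

theorem IsMarking.matches_of_mem (hμ : IsMarking T μ)
    (h : x ∈ PhiBar m n (catArr m n) (T, μ)) : Matches T x := by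
  have hx := (mem_PhiBar_iff.1 h).1
  have hneg : ∀ {j k s t}, j ≠ k → (T.tlt k t j s ↔ key x k t < key x j s) →
      (T.tlt j s k t ↔ key x j s < key x k t) := by
    intro j k s t hne h
    rw [← not_tlt_iff hne.symm, h, not_lt, le_iff_lt_or_eq, key_eq_iff]
    simp [hne]
  have hcore : ∀ i j s, i ≠ j → s ≤ m → ¬ simMu T μ i j →
      (T.tlt i 0 j s ↔ key x i 0 < key x j s) := by
    intro i j s hne hs hsim
    have h1 := sub_lt_and_lt_sub_of_mem h hne hs hsim
    rw [key_lt_iff]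
    push_cast
    by_cases ht : T.tlt i 0 j s
    · have := h1.1 ht
      simp only [ht, true_iff]
      left; linarith
    · have := h1.2 ((not_tlt_iff hne).1 ht)
      simp only [ht, false_iff]
      rintro (h | ⟨h, -⟩) <;> linarith
  intro j k s t hs ht
  by_cases hjk : j = k
  · subst hjk; rw [tlt_self_iff, key_lt_self_iff]
  by_cases hsim : simMu T μ j k
  · rcases hμ.down_or_down hsim with hd | hd
    · exact tlt_iff_of_down hμ hx hd hjk
    · exact hneg hjk (tlt_iff_of_down hμ hx hd (Ne.symm hjk))
  · rcases le_total s t with hst | hst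
    · obtain ⟨u, rfl⟩ := Nat.exists_eq_add_of_le' hst
      have := hcore j k u hjk (by omega) hsim
      rwa [← tlt_add_right s, ← key_lt_add_right_iff s, zero_add] at this
    · obtain ⟨u, rfl⟩ := Nat.exists_eq_add_of_le' hst
      have := hcore k j u (Ne.symm hjk) (by omega) (fun h => hsim (simMu_symm h))
      rw [← tlt_add_right t, ← key_lt_add_right_iff t, zero_add] at this
      exact hneg hjk this

theorem IsMarking.mem_iff_of_mem (hμ : IsMarking T μ)
    (h : x ∈ PhiBar m n (catArr m n) (T, μ)) :
    i ∈ μ ↔ ∃ j s, T.IsChild i j s ∧ x i - x j = (s : ℝ) := by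
  obtain ⟨hx, hx'⟩ := mem_PhiBar_iff.1 h
  constructor
  · intro hi
    obtain ⟨j, s, hj, -⟩ := hμ i hi
    exact ⟨j, s, hj.1, hx i hi j s hj.1⟩
  · rintro ⟨j, s, hj, he⟩
    by_contra hi
    have hsim : ¬ simMu T μ i j := fun hs => hi (hμ.mem_of_simMu hj hs)
    by_cases hT : TrIdx m n i j s
    · have := (hx' i j s hT hsim).2 hj.tlt
      linarith
    · simp only [TrIdx, hj.le, hj.ne, ne_eq, not_false_eq_true, true_and, not_or, not_lt] at hT
      obtain ⟨hs, hij⟩ := hT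
      obtain rfl : s = 0 := by omega
      have := (hx' j i 0 ⟨Nat.zero_le _, hj.ne.symm, Or.inr (lt_of_le_of_ne hij hj.ne)⟩
        (fun h => hsim (simMu_symm h))).1 hj.tlt
      push_cast at *
      linarith

theorem eq_of_mem_PhiBar {p q : MTree m n × Set (Fin n)} (hp : p ∈ OTall m n)
    (hq : q ∈ OTall m n) (hxp : x ∈ PhiBar m n (catArr m n) p)
    (hxq : x ∈ PhiBar m n (catArr m n) q) : p = q := by
  obtain ⟨T, μ⟩ := p
  obtain ⟨T', μ'⟩ := q
  have hμ : IsMarking T μ := hp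
  have hμ' : IsMarking T' μ' := hq
  obtain rfl := (hμ.matches_of_mem hxp).eq (hμ'.matches_of_mem hxq)
  refine Prod.ext rfl (Set.ext fun i => ?_)
  exact (hμ.mem_iff_of_mem hxp).trans (hμ'.mem_iff_of_mem hxq).symm

/-- The set of edges of `T` along which `x` satisfies the equation of a marked edge. -/
def tightEdges (T : MTree m n) (x : Fin n → ℝ) : Set (Fin n) :=
  {i | ∃ j s, T.IsChild i j s ∧ x i - x j = (s : ℝ)}

theorem Matches.isMarking (h : Matches T x) : IsMarking T (tightEdges T x) := by
  rintro i ⟨j, s, hj, he⟩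
  have h1 := (h j i s 0 hj.le (Nat.zero_le _)).1 hj.tlt
  rw [key_lt_iff] at h1
  push_cast at h1
  have h2 : x j < x i ∨ (x j = x i ∧ j < i) := by
    rcases h1 with h1 | h1
    · linarith
    · exact h1.2
  refine ⟨j, s, ⟨hj, ?_⟩, ?_⟩
  · rintro t hst htm ⟨k, hk⟩
    have hst' : ((t - s : ℕ) : ℝ) = t - s := by rw [Nat.cast_sub hst.le]
    have h3 : T.tlt j t i (t - s) :=
      (h _ _ _ _ htm (by omega)).2 (key_lt_iff.2 (Or.inr ⟨by rw [hst']; linarith, h2⟩))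
    have hki : k ≠ i := by
      rintro rfl
      have := (hk.unique hj).2
      omega
    have h4 : T.tlt k 0 i (t - s) := by
      rw [← not_tlt_iff hki.symm]
      exact fun h' => hk.not_tlt_of_tlt h' h3
    have h5 := (h _ _ _ _ (Nat.zero_le _) (by omega)).1 h4
    have h6 := (h _ _ _ _ htm (Nat.zero_le _)).1 hk.tlt
    have hlt : (s : ℝ) < t := by exact_mod_cast hst
    rw [key_lt_iff, hst'] at h5
    rw [key_lt_iff] at h6
    push_cast at h5 h6
    rcases h5 with h5 | ⟨h5, h5' | ⟨h5', -⟩⟩ <;> rcases h6 with h6 | ⟨h6, -⟩ <;> linarith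
  · rintro rfl
    push_cast at he
    rcases h2 with h2 | h2
    · linarith
    · exact h2.2

theorem Matches.simMu (h : Matches T x) (hs : s ≤ m) (he : x i - x j = s)
    (hk : key x j s < key x i 0) : simMu T (tightEdges T x) i j := by
  induction hN : (T.path i).length using Nat.strong_induction_on generalizing i s with
  | _ N ih =>
  have h1 := (h _ _ _ _ hs (Nat.zero_le _)).2 hk
  obtain ⟨k, t, hkt⟩ := exists_isChild (path_ne_nil_of_tlt h1)
  rcases T.tlt_trichotomy k t j s with h2 | ⟨rfl, rfl⟩ | h2
  · exact absurd h2 (hkt.not_tlt_of_tlt h1)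
  · exact .single (Or.inl ⟨⟨k, t, hkt, he⟩, t, hkt⟩)
  · have h3 := (h _ _ _ _ hs hkt.le).1 h2
    have h4 := (h _ _ _ _ hkt.le (Nat.zero_le _)).1 hkt.tlt
    have h3' := key_lt_iff.1 h3
    rw [key_lt_iff] at h4
    push_cast at h4
    have h5 : x k + t = x i := by
      rcases h3' with h3' | ⟨h3', -⟩ <;> rcases h4 with h4 | ⟨h4, -⟩ <;> linarith
    have h6 : x j ≤ x k := by
      rcases h3' with h3' | ⟨h3', h6 | h6⟩ <;> linarith
    have hts : t ≤ s := by
      have : (t : ℝ) ≤ s := by linarith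
      exact_mod_cast this
    obtain ⟨u, rfl⟩ := Nat.exists_eq_add_of_le' hts
    have hp : T.path i = T.path k ++ [t] := hkt
    push_cast at he
    have h7 : key x j u < key x k 0 := (key_lt_add_right_iff t).1 (by rwa [zero_add])
    refine .head (Or.inl ⟨⟨k, t, hkt, by linarith⟩, t, hkt⟩)
      (ih _ (by rw [← hN, hp]; simp) (by omega) (by linarith) h7 rfl)

theorem Matches.mem_PhiBar (h : Matches T x) :
    x ∈ PhiBar m n (catArr m n) (T, tightEdges T x) := by
  rw [mem_PhiBar_iff]
  refine ⟨?_, fun i j s hT hsim => ⟨fun ht => ?_, fun ht => ?_⟩⟩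
  · rintro i ⟨j', s', h1, h2⟩ j s hj
    obtain ⟨rfl, rfl⟩ := hj.unique h1
    exact h2
  · have h1 := (h _ _ _ _ (Nat.zero_le _) hT.1).1 ht
    rw [key_lt_iff] at h1
    push_cast at h1
    have hs0 : (0 : ℝ) ≤ s := Nat.cast_nonneg s
    rcases h1 with h1 | ⟨h1, h2 | ⟨h2, h3⟩⟩
    · linarith
    · linarith
    · exfalso
      have : (s : ℝ) = 0 := by linarith
      have hs : s = 0 := by exact_mod_cast this
      rcases hT.2.2 with h4 | h4
      · omega
      · exact lt_asymm h3 h4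
  · have h1 := (h _ _ _ _ hT.1 (Nat.zero_le _)).1 ht
    have h2 : (s : ℝ) ≠ x i - x j := fun e => hsim (h.simMu hT.1 e.symm h1)
    refine lt_of_le_of_ne ?_ h2
    rw [key_lt_iff] at h1
    push_cast at h1
    rcases h1 with h1 | ⟨h1, -⟩ <;> linarith

theorem exists_mem_PhiBar (m : ℕ) (x : Fin n → ℝ) :
    ∃ p ∈ OTall m n, x ∈ PhiBar m n (catArr m n) p :=
  ⟨(treeOf m x, tightEdges (treeOf m x) x), (matches_treeOf m x).isMarking,
    (matches_treeOf m x).mem_PhiBar⟩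

open Classical in
/-- The number of blocks starting at or before the node `i` in the order `pre`. -/
noncomputable def blockRank (T : MTree m n) (μ : Set (Fin n)) (i : Fin n) : ℕ :=
  (Finset.univ.filter fun k => k ∉ μ ∧ ¬ pre (T.path i) (T.path k)).card

theorem blockRank_le (T : MTree m n) (μ : Set (Fin n)) (i : Fin n) : blockRank T μ i ≤ n := by
  unfold blockRank
  exact (Finset.card_le_univ _).trans_eq (Fintype.card_fin n)

theorem IsMarking.blockRank_eq (hμ : IsMarking T μ) (hi : i ∈ μ) (h : T.IsChild i j s) :
    blockRank T μ i = blockRank T μ j := by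
  classical
  unfold blockRank
  congr 1
  ext k
  simp only [Finset.mem_filter, Finset.mem_univ, true_and, and_congr_right_iff, not_iff_not]
  intro hk
  refine ⟨fun h' => pre_trans h.pre_path h', fun h' => ?_⟩
  by_contra hcon
  exact hk ((hμ.isCadet hi h).1.eq_of_between h' hcon ▸ hi)

theorem IsMarking.blockRank_lt (hμ : IsMarking T μ) (hsim : ¬ simMu T μ i j)
    (h : pre (T.path i) (T.path j)) : blockRank T μ i < blockRank T μ j := by
  classical
  obtain ⟨k, hk, hkj⟩ := exists_down_not_mem hμ j
  have hik : pre (T.path i) (T.path k) := by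
    by_contra hcon
    exact hsim ((hμ.simMu_of_between hkj hcon (pre_asymm h)).trans hkj.simMu)
  refine Finset.card_lt_card ((Finset.ssubset_iff_of_subset ?_).2 ⟨k, ?_, ?_⟩)
  · intro l
    simp only [Finset.mem_filter, Finset.mem_univ, true_and]
    exact fun hl => ⟨hl.1, fun h' => hl.2 (pre_trans h h')⟩
  · simp only [Finset.mem_filter, Finset.mem_univ, true_and]
    refine ⟨hk, fun h' => ?_⟩
    rcases hkj.eq_or_pre with rfl | h''
    · exact pre_irrefl _ h'
    · exact pre_asymm h' h''
  · simp [hik]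

theorem IsMarking.nonempty_PhiBar (hμ : IsMarking T μ) :
    (PhiBar m n (catArr m n) (T, μ)).Nonempty := by
  refine ⟨fun i => T.drift i + blockRank T μ i / (n + 1 : ℝ), mem_PhiBar_iff.2 ⟨?_, ?_⟩⟩
  · intro i hi j s h
    simp only [hμ.blockRank_eq hi h, h.drift_eq]
    push_cast
    ring
  · intro i j s _ hsim
    have hn : (0 : ℝ) < n + 1 := by positivity
    have key : ∀ a b : Fin n, ∀ s t : ℕ, ¬ simMu T μ a b → T.tlt a s b t →
        (T.drift a + blockRank T μ a / (n + 1 : ℝ)) + s <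
          (T.drift b + blockRank T μ b / (n + 1 : ℝ)) + t := by
      intro a b s t hab h
      have h0 : (0 : ℝ) ≤ blockRank T μ b / (n + 1 : ℝ) := by positivity
      have h1 : blockRank T μ a / (n + 1 : ℝ) < 1 := by
        rw [div_lt_one hn]
        exact_mod_cast Nat.lt_succ_of_le (blockRank_le T μ a)
      rcases h with h | ⟨h, hp⟩
      · have : ((T.drift a + s + 1 : ℕ) : ℝ) ≤ (T.drift b + t : ℕ) := by exact_mod_cast h
        push_cast at this
        linarith
      · have h2 : ((T.drift a + s : ℕ) : ℝ) = (T.drift b + t : ℕ) := by exact_mod_cast h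
        have h3 : (blockRank T μ a : ℝ) < blockRank T μ b := by
          exact_mod_cast hμ.blockRank_lt hab hp
        have h4 := div_lt_div_of_pos_right h3 hn
        push_cast at h2
        linarith
    constructor
    · intro h
      have := key i j 0 s hsim h
      push_cast at this
      linarith
    · intro h
      have := key j i s 0 (fun h => hsim (simMu_symm h)) h
      push_cast at this
      linarith

end Blocks

section Faces

variable {m n : ℕ} {T : MTree m n} {μ : Set (Fin n)} {x y : Fin n → ℝ}

/-- Two points lie both on `H`, or on the same side of `H`. -/
def SameSide {n : ℕ} (H : Set (Fin n → ℝ)) (x y : Fin n → ℝ) : Prop :=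
  (x ∈ H ∧ y ∈ H) ∨ ∀ c : ℝ, 0 ≤ c → c ≤ 1 → (1 - c) • x + c • y ∉ H

theorem sameSide_hyp_iff {i j : Fin n} {s : ℝ} : SameSide (hyp n i j s) x y ↔
    (x i - x j = s ∧ y i - y j = s) ∨ (x i - x j < s ∧ y i - y j < s) ∨
      (s < x i - x j ∧ s < y i - y j) := by
  have e : ∀ c : ℝ, (1 - c) • x + c • y ∈ hyp n i j s ↔
      (1 - c) * (x i - x j - s) + c * (y i - y j - s) = 0 := by
    intro c
    simp only [hyp, Set.mem_ofPred_eq, Pi.add_apply, Pi.smul_apply, smul_eq_mul]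
    constructor <;> intro h <;> linarith
  simp only [SameSide, e]
  refine or_congr Iff.rfl ⟨fun h => ?_, fun h c h0 h1 => ?_⟩
  · have hx : x i - x j - s ≠ 0 := by simpa using h 0 le_rfl zero_le_one
    have hy : y i - y j - s ≠ 0 := by simpa using h 1 zero_le_one le_rfl
    have hcross : ∀ a b : ℝ, a * b < 0 → ∃ c : ℝ, 0 ≤ c ∧ c ≤ 1 ∧ (1 - c) * a + c * b = 0 := by
      intro a b hab
      rcases mul_neg_iff.1 hab with ⟨ha, hb⟩ | ⟨ha, hb⟩
      · have hd : 0 < a - b := by linarith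
        refine ⟨a / (a - b), by positivity, (div_le_one hd).2 (by linarith), ?_⟩
        field_simp
        ring
      · have hd : 0 < b - a := by linarith
        refine ⟨-a / (b - a), div_nonneg (by linarith) hd.le, (div_le_one hd).2 (by linarith), ?_⟩
        field_simp
        ring
    have hxy : ¬ (x i - x j - s) * (y i - y j - s) < 0 := by
      intro hneg
      obtain ⟨c, h0, h1, hc⟩ := hcross _ _ hneg
      exact h c h0 h1 hc
    rcases lt_or_gt_of_ne hx with hx | hx <;> rcases lt_or_gt_of_ne hy with hy | hy
    · exact Or.inl ⟨by linarith, by linarith⟩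
    · exact absurd (mul_neg_of_neg_of_pos hx hy) hxy
    · exact absurd (mul_neg_of_pos_of_neg hx hy) hxy
    · exact Or.inr ⟨by linarith, by linarith⟩
  · rcases h with ⟨hx, hy⟩ | ⟨hx, hy⟩
    · have : (1 - c) * (x i - x j - s) + c * (y i - y j - s) < 0 := by
        rcases h0.eq_or_lt with rfl | h0
        · linarith
        · have := mul_neg_of_pos_of_neg h0 (sub_neg.2 hy)
          have := mul_nonpos_of_nonneg_of_nonpos (sub_nonneg.2 h1) (sub_neg.2 hx).le
          linarith
      exact this.ne
    · have : 0 < (1 - c) * (x i - x j - s) + c * (y i - y j - s) := by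
        rcases h0.eq_or_lt with rfl | h0
        · linarith
        · have := mul_pos h0 (sub_pos.2 hy)
          have := mul_nonneg (sub_nonneg.2 h1) (sub_pos.2 hx).le
          linarith
      exact this.ne'

theorem IsSideOf.mem_iff {σ H : Set (Fin n → ℝ)} (hH : H ∈ catArr m n) (h : IsSideOf n σ H)
    (hx : x ∈ σ) : y ∈ σ ↔ SameSide H x y := by
  rcases h with rfl | ⟨i, j, s, -, rfl, rfl | rfl⟩
  · obtain ⟨i, j, s, -, -, -, rfl⟩ := hH
    simp only [hyp, Set.mem_ofPred_eq] at hx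
    rw [sameSide_hyp_iff]
    simp [hyp, hx]
  · simp only [Set.mem_ofPred_eq] at hx
    rw [sameSide_hyp_iff]
    simp [hx, hx.ne, hx.not_gt]
  · simp only [Set.mem_ofPred_eq] at hx
    rw [sameSide_hyp_iff]
    simp [hx, hx.ne', hx.not_gt]

/-- The face of the Catalan arrangement containing `x`. -/
def faceOf (m : ℕ) {n : ℕ} (x : Fin n → ℝ) : Set (Fin n → ℝ) :=
  {y | ∀ H ∈ catArr m n, SameSide H x y}

theorem IsFace.eq_faceOf {F : Set (Fin n → ℝ)} (h : IsFace n (catArr m n) F) (hx : x ∈ F) :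
    F = faceOf m x := by
  obtain ⟨-, σ, hσ, rfl⟩ := h
  ext y
  simp only [Set.mem_iInter] at hx
  simp only [Set.mem_iInter, faceOf, Set.mem_ofPred_eq]
  exact forall₂_congr fun H hH => (hσ H hH).mem_iff hH (hx H hH)

theorem mem_faceOf_self (m : ℕ) (x : Fin n → ℝ) : x ∈ faceOf m x := by
  rintro H ⟨i, j, s, -, -, -, rfl⟩
  rw [sameSide_hyp_iff]
  rcases lt_trichotomy (x i - x j) s with h | h | h <;> simp [h]

theorem isFace_faceOf (m : ℕ) (x : Fin n → ℝ) : IsFace n (catArr m n) (faceOf m x) := by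
  refine ⟨⟨x, mem_faceOf_self m x⟩, fun H => {y | SameSide H x y}, ?_, ?_⟩
  · rintro H ⟨i, j, s, hij, -, -, rfl⟩
    simp only [sameSide_hyp_iff]
    rcases lt_trichotomy (x i - x j) s with h | h | h
    · refine Or.inr ⟨i, j, s, hij.ne, rfl, Or.inl ?_⟩
      simp [h, h.ne, h.not_gt]
    · refine Or.inl ?_
      simp [h, hyp]
    · refine Or.inr ⟨i, j, s, hij.ne, rfl, Or.inr ?_⟩
      simp [h, h.ne', h.not_gt]
  · ext y; simp [faceOf]

theorem PhiBar_eq_faceOf (hx : x ∈ PhiBar m n (catArr m n) (T, μ)) :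
    PhiBar m n (catArr m n) (T, μ) = faceOf m x := by
  have hx' := mem_PhiBar_iff.1 hx
  ext y
  constructor
  · intro hy
    have hy' := mem_PhiBar_iff.1 hy
    rintro H ⟨i, j, s, hij, h₁, h₂, rfl⟩
    rw [sameSide_hyp_iff]
    by_cases hsim : simMu T μ i j
    · rw [sub_eq_drift_of_simMu hx'.1 hsim, sub_eq_drift_of_simMu hy'.1 hsim]
      rcases lt_trichotomy ((T.drift i : ℝ) - T.drift j) s with h | h | h <;> simp [h]
    · rcases le_total 0 s with hs | hs
      · obtain ⟨t, rfl⟩ := Int.eq_ofNat_of_zero_le hs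
        have h3 := sub_lt_and_lt_sub_of_mem hx hij.ne (by omega : t ≤ m) hsim
        have h4 := sub_lt_and_lt_sub_of_mem hy hij.ne (by omega : t ≤ m) hsim
        push_cast
        by_cases ht : T.tlt i 0 j t
        · exact Or.inr (Or.inl ⟨h3.1 ht, h4.1 ht⟩)
        · rw [not_tlt_iff hij.ne] at ht
          exact Or.inr (Or.inr ⟨h3.2 ht, h4.2 ht⟩)
      · obtain ⟨t, ht⟩ := Int.eq_ofNat_of_zero_le (neg_nonneg.2 hs)
        obtain rfl : s = -(t : ℤ) := by omega
        have hsim' : ¬ simMu T μ j i := fun h => hsim (simMu_symm h)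
        have h3 := sub_lt_and_lt_sub_of_mem hx hij.ne' (by omega : t ≤ m) hsim'
        have h4 := sub_lt_and_lt_sub_of_mem hy hij.ne' (by omega : t ≤ m) hsim'
        push_cast
        by_cases ht : T.tlt j 0 i t
        · exact Or.inr (Or.inr ⟨by linarith [h3.1 ht], by linarith [h4.1 ht]⟩)
        · rw [not_tlt_iff hij.ne'] at ht
          exact Or.inr (Or.inl ⟨by linarith [h3.2 ht], by linarith [h4.2 ht]⟩)
  · intro hy
    rw [mem_PhiBar_iff]
    have hside : ∀ i j s, i ≠ j → s ≤ m → (x i - x j = s ∧ y i - y j = s) ∨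
        (x i - x j < s ∧ y i - y j < s) ∨ ((s : ℝ) < x i - x j ∧ (s : ℝ) < y i - y j) :=
      fun i j s hne hs => sameSide_hyp_iff.1 (hy _ (hyp_natCast_mem_catArr hne hs))
    refine ⟨fun i hi j s h => ?_, fun i j s hT hsim => ⟨fun ht => ?_, fun ht => ?_⟩⟩
    · have h1 := hx'.1 i hi j s h
      rcases hside i j s h.ne h.le with h2 | h2 | h2 <;> linarith
    · have h1 := (hx'.2 i j s hT hsim).1 ht
      rcases hside i j s hT.2.1 hT.1 with h2 | h2 | h2 <;> linarith
    · have h1 := (hx'.2 i j s hT hsim).2 ht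
      rcases hside i j s hT.2.1 hT.1 with h2 | h2 | h2 <;> linarith

theorem bijOn_PhiBar (m n : ℕ) : Set.BijOn (PhiBar m n (catArr m n)) (OTall m n)
    {F | IsFace n (catArr m n) F} := by
  refine ⟨?_, ?_, ?_⟩
  · rintro ⟨T, μ⟩ (hμ : IsMarking T μ)
    obtain ⟨x, hx⟩ := hμ.nonempty_PhiBar
    rw [Set.mem_ofPred_eq, PhiBar_eq_faceOf hx]
    exact isFace_faceOf m x
  · rintro ⟨T, μ⟩ (hμ : IsMarking T μ) q hq heq
    obtain ⟨x, hx⟩ := hμ.nonempty_PhiBar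
    exact eq_of_mem_PhiBar hμ hq hx (heq ▸ hx)
  · intro F hF
    obtain ⟨x, hx⟩ := hF.1
    obtain ⟨⟨T, μ⟩, hp, hxp⟩ := exists_mem_PhiBar m x
    refine ⟨(T, μ), hp, ?_⟩
    rw [PhiBar_eq_faceOf hxp, IsFace.eq_faceOf hF hx]

theorem OTset_catArr (m n : ℕ) : OTset m n (catArr m n) = OTall m n := by
  ext ⟨T, μ⟩
  refine ⟨fun h => h.1, fun h => ⟨h, ?_, ?_⟩⟩
  · have hedge : ∀ a b, MarkedEdge T μ a b →
        hyp n a b ((T.drift a : ℝ) - (T.drift b : ℝ)) ∈ catArr m n := by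
      intro a b hab
      have e : (T.drift a : ℝ) - (T.drift b : ℝ) = (((T.drift a : ℤ) - T.drift b : ℤ) : ℝ) := by
        push_cast; ring
      rw [e]
      rcases hab with ⟨-, s, hs⟩ | ⟨-, s, hs⟩
      · have h1 := hs.drift_eq
        have h2 := hs.le
        exact hyp_mem_catArr hs.ne (by omega) (by omega)
      · have h1 := hs.drift_eq
        have h2 := hs.le
        exact hyp_mem_catArr hs.ne.symm (by omega) (by omega)
    rintro B ⟨r, rfl⟩ i hi j hj
    have hij : simMu T μ i j := (simMu_symm hi).trans hj
    clear hj
    induction hij with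
    | refl => exact .refl
    | tail hib hbc ih =>
      exact ih.tail ⟨Relation.ReflTransGen.trans hi hib,
        Relation.ReflTransGen.trans hi (hib.tail hbc), hedge _ _ hbc⟩
  · intro i j s hc _
    refine Or.inr ⟨i, j, .refl, .refl, ?_⟩
    rw [hc.1.drift_eq]
    push_cast
    rw [add_sub_cancel_left]
    exact hyp_natCast_mem_catArr hc.1.ne hc.1.le

end Faces

section Codim

variable {m n : ℕ} {T : MTree m n} {μ : Set (Fin n)} {x v : Fin n → ℝ}

open Filter Topology in
theorem exists_add_smul_mem_PhiBar (hx : x ∈ PhiBar m n (catArr m n) (T, μ))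
    (hv : ∀ i ∈ μ, ∀ j s, T.IsChild i j s → v i = v j) :
    ∃ c : ℝ, c ≠ 0 ∧ x + c • v ∈ PhiBar m n (catArr m n) (T, μ) := by
  have hx' := mem_PhiBar_iff.1 hx
  have hlim : ∀ i j, Tendsto (fun c : ℝ => (x + c • v) i - (x + c • v) j) (𝓝 0)
      (𝓝 (x i - x j)) := by
    intro i j
    have : Continuous fun c : ℝ => (x + c • v) i - (x + c • v) j := by
      simp only [Pi.add_apply, Pi.smul_apply, smul_eq_mul]
      fun_prop
    simpa using this.tendsto 0
  have hev : ∀ᶠ c in 𝓝 (0 : ℝ), ∀ i j, ∀ s ∈ Finset.range (m + 1),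
      (x i - x j < s → (x + c • v) i - (x + c • v) j < s) ∧
      ((s : ℝ) < x i - x j → (s : ℝ) < (x + c • v) i - (x + c • v) j) := by
    refine eventually_all.2 fun i => eventually_all.2 fun j =>
      (Filter.eventually_all_finset _).2 fun s _ => Filter.Eventually.and ?_ ?_
    · by_cases h : x i - x j < s
      · simpa only [h, true_imp_iff] using (hlim i j).eventually_lt_const h
      · simp [h]
    · by_cases h : (s : ℝ) < x i - x j
      · simpa only [h, true_imp_iff] using (hlim i j).eventually_const_lt h
      · simp [h]
  obtain ⟨c, hc, hc0⟩ := ((hev.filter_mono nhdsWithin_le_nhds).and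
    (self_mem_nhdsWithin : {(0 : ℝ)}ᶜ ∈ 𝓝[≠] (0 : ℝ))).exists
  refine ⟨c, hc0, mem_PhiBar_iff.2 ⟨fun i hi j s h => ?_, fun i j s hT hsim => ?_⟩⟩
  · have h1 := hx'.1 i hi j s h
    simp only [Pi.add_apply, Pi.smul_apply, smul_eq_mul, hv i hi j s h]
    linarith
  · have h1 := hx'.2 i j s hT hsim
    have h2 := hc i j s (Finset.mem_range_succ_iff.2 hT.1)
    exact ⟨fun ht => h2.1 (h1.1 ht), fun ht => h2.2 (h1.2 ht)⟩

/-- The map sending `v` to its differences along the marked edges, where `par` gives parents. -/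
def edgeDiff (μ : Set (Fin n)) (par : μ → Fin n) : (Fin n → ℝ) →ₗ[ℝ] (μ → ℝ) :=
  LinearMap.pi fun i => (LinearMap.proj (i : Fin n) : (Fin n → ℝ) →ₗ[ℝ] ℝ) -
    LinearMap.proj (par i)

theorem edgeDiff_surjective (par : μ → Fin n) (ht : ∀ i : μ, ∃ s, T.IsChild i (par i) s) :
    Function.Surjective (edgeDiff μ par) := by
  classical
  intro w
  refine ⟨fun i => ∑ k ∈ Finset.univ.filter fun k : μ => T.path k <+: T.path i, w k, funext fun i => ?_⟩
  obtain ⟨s, hs⟩ := ht i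
  have hp : T.path i = T.path (par i) ++ [s] := hs
  have e : (Finset.univ.filter fun k : μ => T.path k <+: T.path i) =
      insert i (Finset.univ.filter fun k : μ => T.path k <+: T.path (par i)) := by
    ext k
    simp only [Finset.mem_filter, Finset.mem_univ, true_and, Finset.mem_insert]
    rw [hp, List.prefix_concat_iff, ← hp]
    refine or_congr ⟨fun h => Subtype.ext (T.inj h), fun h => by rw [h]⟩ Iff.rfl
  have hni : i ∉ Finset.univ.filter fun k : μ => T.path k <+: T.path (par i) := by
    simp only [Finset.mem_filter, Finset.mem_univ, true_and, hp]
    intro h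
    have := h.length_le
    simp at this
  simp only [edgeDiff, LinearMap.pi_apply, LinearMap.sub_apply, LinearMap.proj_apply]
  rw [e, Finset.sum_insert hni]
  ring

theorem IsMarking.codim_PhiBar (hμ : IsMarking T μ) :
    codim n (PhiBar m n (catArr m n) (T, μ)) = μ.ncard := by
  classical
  choose par hpar using fun i : μ => hμ i i.2
  have hchild : ∀ i : μ, ∃ s, T.IsChild i (par i) s := fun i => by
    obtain ⟨s, hs, -⟩ := hpar i
    exact ⟨s, hs.1⟩
  obtain ⟨x, hx⟩ := hμ.nonempty_PhiBar
  have hdir : (affineSpan ℝ (PhiBar m n (catArr m n) (T, μ))).direction =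
      LinearMap.ker (edgeDiff μ par) := by
    rw [direction_affineSpan]
    apply le_antisymm
    · rw [vectorSpan, Submodule.span_le]
      rintro _ ⟨y, hy, z, hz, rfl⟩
      refine LinearMap.mem_ker.2 (funext fun i => ?_)
      obtain ⟨s, hs⟩ := hchild i
      have h1 := (mem_PhiBar_iff.1 hy).1 i i.2 _ s hs
      have h2 := (mem_PhiBar_iff.1 hz).1 i i.2 _ s hs
      simp only [edgeDiff, vsub_eq_sub, LinearMap.pi_apply, LinearMap.sub_apply,
        LinearMap.proj_apply, Pi.sub_apply, Pi.zero_apply]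
      linarith
    · intro v hv
      have hv' : ∀ i ∈ μ, ∀ j s, T.IsChild i j s → v i = v j := by
        intro i hi j s h
        obtain ⟨t, ht⟩ := hchild ⟨i, hi⟩
        have h1 := congrFun (LinearMap.mem_ker.1 hv) ⟨i, hi⟩
        simp only [edgeDiff, LinearMap.pi_apply, LinearMap.sub_apply, LinearMap.proj_apply,
          Pi.zero_apply] at h1
        rw [(h.unique ht).1]
        linarith
      obtain ⟨c, hc, hmem⟩ := exists_add_smul_mem_PhiBar hx hv'
      have h1 := vsub_mem_vectorSpan ℝ hmem hx
      rw [vsub_eq_sub, add_sub_cancel_left] at h1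
      exact (Submodule.smul_mem_iff _ hc).1 h1
  rw [codim, hdir,
    ((edgeDiff μ par).quotKerEquivOfSurjective (edgeDiff_surjective par hchild)).finrank_eq,
    Module.finrank_fintype_fun_eq_card, ← Nat.card_eq_fintype_card, Nat.card_coe_set_eq]

end Codim

end Braid

theorem catalan_faces (m n : ℕ) (hm : 0 < m) (hn : 0 < n) :
    Braid.OTset m n (Braid.catArr m n) = Braid.OTall m n ∧
    Set.BijOn (Braid.PhiBar m n (Braid.catArr m n))
      (Braid.OTall m n) {F | Braid.IsFace n (Braid.catArr m n) F} ∧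
    (∀ p ∈ Braid.OTall m n,
      Braid.codim n (Braid.PhiBar m n (Braid.catArr m n) p) = p.2.ncard) ∧
    ∀ k : ℕ,
      Set.BijOn (Braid.PhiBar m n (Braid.catArr m n))
        {p | p ∈ Braid.OTall m n ∧ p.2.ncard = k}
        {F | Braid.IsFace n (Braid.catArr m n) F ∧ Braid.codim n F = k} := by
  have hcodim : ∀ p ∈ Braid.OTall m n,
      Braid.codim n (Braid.PhiBar m n (Braid.catArr m n) p) = p.2.ncard :=
    fun p hp => Braid.IsMarking.codim_PhiBar hp
  have hbij := Braid.bijOn_PhiBar m n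
  refine ⟨Braid.OTset_catArr m n, hbij, hcodim, fun k => ⟨?_, ?_, ?_⟩⟩
  · exact fun p hp => ⟨hbij.mapsTo hp.1, (hcodim p hp.1).trans hp.2⟩
  · exact hbij.injOn.mono fun p hp => hp.1
  · rintro F ⟨hF, hk⟩
    obtain ⟨p, hp, rfl⟩ := hbij.surjOn hF
    exact ⟨p, ⟨hp, (hcodim p hp).symm.trans hk⟩, rfl⟩
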